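/- The intermediate odd symplectic group T̃Sp_{2n+1} = {g ∈ Sp_{2n+2}(ω̃) : g(e_0) = e_0} is contained in P, and its image under the restriction homomorphism g ↦ g|_E is exactly the subgroup {g ∈ Sp_{2n+1}(ω) : det g = 1} of elements of determinant 1 in the odd symplectic group. -/

import Mathlib

open Module Submodule

noncomputable section

variable {Et : Type*} [AddCommGroup Et] [Module ℂ Et]

/-- The group of linear automorphisms preserving a bilinear form
(the symplectic / odd symplectic group of the form). -/
def sympGroup {E : Type*} [AddCommGroup E] [Module ℂ E]
    (ω : LinearMap.BilinForm ℂ E) : Subgroup (E ≃ₗ[ℂ] E) where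
  carrier := {g | ∀ x y : E, ω (g x) (g y) = ω x y}
  one_mem' := fun _ _ => rfl
  mul_mem' := by
    intro a b ha hb x y
    simp only [Set.mem_setOf_eq] at ha hb ⊢
    rw [show (a * b) x = a (b x) from rfl, show (a * b) y = a (b y) from rfl, ha, hb]
  inv_mem' := by
    intro a ha x y
    simp only [Set.mem_setOf_eq] at ha ⊢
    have h1 : a ((a⁻¹ : _ ≃ₗ[ℂ] _) x) = x := a.apply_symm_apply x
    have h2 : a ((a⁻¹ : _ ≃ₗ[ℂ] _) y) = y := a.apply_symm_apply y
    calc ω ((a⁻¹ : _ ≃ₗ[ℂ] _) x) ((a⁻¹ : _ ≃ₗ[ℂ] _) y)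
        = ω (a ((a⁻¹ : _ ≃ₗ[ℂ] _) x)) (a ((a⁻¹ : _ ≃ₗ[ℂ] _) y)) := (ha _ _).symm
      _ = ω x y := by rw [h1, h2]

/-- Subgroup of automorphisms mapping a given submodule onto itself. -/
def stabSubgroup {E : Type*} [AddCommGroup E] [Module ℂ E]
    (F : Submodule ℂ E) : Subgroup (E ≃ₗ[ℂ] E) where
  carrier := {g | Submodule.map (g : E →ₗ[ℂ] E) F = F}
  one_mem' := by simp
  mul_mem' := by
    intro a b ha hb
    simp only [Set.mem_setOf_eq] at ha hb ⊢
    have : ((a * b : E ≃ₗ[ℂ] E) : E →ₗ[ℂ] E) = (a : E →ₗ[ℂ] E).comp (b : E →ₗ[ℂ] E) := rfl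
    rw [this, Submodule.map_comp, hb, ha]
  inv_mem' := by
    intro a ha
    simp only [Set.mem_setOf_eq] at ha ⊢
    conv_lhs => rw [← ha]
    rw [← Submodule.map_comp]
    have : ((a⁻¹ : E ≃ₗ[ℂ] E) : E →ₗ[ℂ] E).comp (a : E →ₗ[ℂ] E) = LinearMap.id := by
      ext x
      exact a.symm_apply_apply x
    rw [this, Submodule.map_id]

/-- The parabolic subgroup `P` of `Sp_{2n+2}(ω̃)` preserving the line `ℂe₀`. -/
def Psub (n : ℕ) (ωt : LinearMap.BilinForm ℂ Et) (et : Basis (Fin (2 * n + 2)) ℂ Et) :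
    Subgroup (Et ≃ₗ[ℂ] Et) :=
  sympGroup ωt ⊓ stabSubgroup (Submodule.span ℂ {et 0})

/-- The hyperplane `E = span(e₀, …, e_{2n})` of `Ẽ`. -/
def Ehyp (n : ℕ) (et : Basis (Fin (2 * n + 2)) ℂ Et) : Submodule ℂ Et :=
  Submodule.span ℂ (Set.range fun i : Fin (2 * n + 1) => et i.castSucc)


/-- Linear automorphisms preserving a bilinear form with Gram matrix `J` have determinant `1`. -/
theorem det_eq_one_of_toMatrix_eq_J {l V : Type*} [Fintype l] [DecidableEq l] [AddCommGroup V]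
    [Module ℂ V] {ω : LinearMap.BilinForm ℂ V} (b : Basis (l ⊕ l) ℂ V)
    (hb : LinearMap.BilinForm.toMatrix b ω = Matrix.J l ℂ) {g : V ≃ₗ[ℂ] V}
    (hg : g ∈ sympGroup ω) : LinearMap.det (g : V →ₗ[ℂ] V) = 1 := by
  rw [← LinearMap.det_toMatrix b]
  apply SymplecticGroup.det_eq_one
  rw [SymplecticGroup.mem_iff', ← hb, ← LinearMap.BilinForm.toMatrix_comp b b]
  congr 1
  ext x y
  exact hg x y

/-- The reindexing of `Fin (2 * n + 2)` that puts a symplectic basis in block form: the left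
summand enumerates the second half of the basis backwards, the right summand the first half. -/
def symplecticReindex (n : ℕ) : Fin (n + 1) ⊕ Fin (n + 1) ≃ Fin (2 * n + 2) :=
  (Equiv.sumComm _ _).trans <| (Equiv.sumCongr (Equiv.refl _) Fin.revPerm).trans <|
    finSumFinEquiv.trans <| finCongr (by omega)

theorem symplecticReindex_inl (n : ℕ) (k : Fin (n + 1)) :
    (symplecticReindex n (Sum.inl k) : ℕ) = 2 * n + 1 - k := by
  simp [symplecticReindex, Fin.val_rev]
  omega

theorem symplecticReindex_inr (n : ℕ) (k : Fin (n + 1)) :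
    (symplecticReindex n (Sum.inr k) : ℕ) = k := by
  simp [symplecticReindex]

section SymplecticBasis

variable {n : ℕ} {ωt : LinearMap.BilinForm ℂ Et} {et : Basis (Fin (2 * n + 2)) ℂ Et}

theorem toMatrix_symplecticReindex (halt : ωt.IsAlt)
    (het : ∀ i j : Fin (2 * n + 2), (i : ℕ) < (j : ℕ) →
      ωt (et i) (et j) = if (i : ℕ) + (j : ℕ) = 2 * n + 1 then 1 else 0) :
    LinearMap.BilinForm.toMatrix (et.reindex (symplecticReindex n).symm) ωt =
      Matrix.J (Fin (n + 1)) ℂ := by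
  have hpair : ∀ i j : Fin (2 * n + 2), (i : ℕ) + j ≠ 2 * n + 1 → ωt (et i) (et j) = 0 := by
    intro i j hij
    rcases lt_trichotomy (i : ℕ) j with h | h | h
    · rw [het i j h, if_neg hij]
    · rw [Fin.ext h, halt]
    · rw [← halt.neg_eq, het j i h, if_neg (by omega), neg_zero]
  ext i j
  rw [LinearMap.BilinForm.toMatrix_apply]
  simp only [Basis.reindex_apply, Equiv.symm_symm]
  rcases i with i | i <;> rcases j with j | j <;> simp only [Matrix.J, Matrix.fromBlocks_apply₁₁,
    Matrix.fromBlocks_apply₁₂, Matrix.fromBlocks_apply₂₁, Matrix.fromBlocks_apply₂₂]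
  · refine hpair _ _ ?_
    rw [symplecticReindex_inl, symplecticReindex_inl]
    omega
  · rw [← halt.neg_eq, het _ _ (by rw [symplecticReindex_inl, symplecticReindex_inr]; omega),
      symplecticReindex_inl, symplecticReindex_inr, Matrix.neg_apply, Matrix.one_apply]
    congr 1
    refine if_congr ?_ rfl rfl
    rw [Fin.ext_iff]
    omega
  · rw [het _ _ (by rw [symplecticReindex_inl, symplecticReindex_inr]; omega),
      symplecticReindex_inl, symplecticReindex_inr, Matrix.one_apply]
    refine if_congr ?_ rfl rfl
    rw [Fin.ext_iff]
    omega
  · refine hpair _ _ ?_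
    rw [symplecticReindex_inr, symplecticReindex_inr]
    omega

theorem nondegenerate_of_symplecticBasis (halt : ωt.IsAlt)
    (het : ∀ i j : Fin (2 * n + 2), (i : ℕ) < (j : ℕ) →
      ωt (et i) (et j) = if (i : ℕ) + (j : ℕ) = 2 * n + 1 then 1 else 0) :
    ωt.Nondegenerate :=
  LinearMap.BilinForm.nondegenerate_of_det_ne_zero _ (et.reindex (symplecticReindex n).symm) <| by
    rw [toMatrix_symplecticReindex halt het]
    exact (Matrix.isUnit_det_J (Fin (n + 1)) ℂ).ne_zero

theorem form_zero_castSucc (halt : ωt.IsAlt)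
    (het : ∀ i j : Fin (2 * n + 2), (i : ℕ) < (j : ℕ) →
      ωt (et i) (et j) = if (i : ℕ) + (j : ℕ) = 2 * n + 1 then 1 else 0)
    (i : Fin (2 * n + 1)) : ωt (et 0) (et i.castSucc) = 0 := by
  rcases Nat.eq_zero_or_pos i with h | h
  · rw [show i.castSucc = 0 from Fin.ext h, halt]
  · rw [het 0 i.castSucc h, if_neg]
    simp
    omega

theorem form_zero_last
    (het : ∀ i j : Fin (2 * n + 2), (i : ℕ) < (j : ℕ) →
      ωt (et i) (et j) = if (i : ℕ) + (j : ℕ) = 2 * n + 1 then 1 else 0) :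
    ωt (et 0) (et (Fin.last _)) = 1 := by
  rw [het 0 (Fin.last _) (by simp), if_pos (by simp)]

theorem basis_zero_mem_Ehyp : et 0 ∈ Ehyp n et :=
  Submodule.subset_span ⟨0, rfl⟩

/-- The hyperplane `E` is the orthogonal complement of `e₀`. -/
theorem mem_Ehyp_iff (halt : ωt.IsAlt)
    (het : ∀ i j : Fin (2 * n + 2), (i : ℕ) < (j : ℕ) →
      ωt (et i) (et j) = if (i : ℕ) + (j : ℕ) = 2 * n + 1 then 1 else 0) (x : Et) :
    x ∈ Ehyp n et ↔ ωt (et 0) x = 0 := by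
  constructor
  · intro hx
    have hle : Ehyp n et ≤ LinearMap.ker (ωt (et 0)) := by
      rw [Ehyp, Submodule.span_le]
      rintro _ ⟨i, rfl⟩
      exact form_zero_castSucc halt het i
    exact hle hx
  · intro hx
    rw [← et.sum_repr x, Fin.sum_univ_castSucc] at hx ⊢
    have hlast : et.repr x (Fin.last _) = 0 := by
      simpa [form_zero_castSucc halt het, form_zero_last het] using hx
    rw [hlast, zero_smul, add_zero]
    exact Submodule.sum_mem _ fun i _ =>
      Submodule.smul_mem _ _ (Submodule.subset_span ⟨i, rfl⟩)

theorem exists_add_smul_last (halt : ωt.IsAlt)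
    (het : ∀ i j : Fin (2 * n + 2), (i : ℕ) < (j : ℕ) →
      ωt (et i) (et j) = if (i : ℕ) + (j : ℕ) = 2 * n + 1 then 1 else 0) (y : Et) :
    ∃ (x : Ehyp n et) (a : ℂ), y = x + a • et (Fin.last _) := by
  refine ⟨⟨y - ωt (et 0) y • et (Fin.last _), ?_⟩, ωt (et 0) y, by simp⟩
  rw [mem_Ehyp_iff halt het]
  simp [form_zero_last het]

/-- Odd symplectic automorphisms preserve the kernel `ℂe₀` of the form on `E`. -/
theorem exists_apply_zero_eq_smul (halt : ωt.IsAlt)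
    (het : ∀ i j : Fin (2 * n + 2), (i : ℕ) < (j : ℕ) →
      ωt (et i) (et j) = if (i : ℕ) + (j : ℕ) = 2 * n + 1 then 1 else 0)
    {h : Ehyp n et ≃ₗ[ℂ] Ehyp n et} (hh : h ∈ sympGroup (ωt.restrict (Ehyp n et))) :
    ∃ c : ℂ, c ≠ 0 ∧ (h ⟨et 0, basis_zero_mem_Ehyp⟩ : Et) = c • et 0 := by
  set z : Ehyp n et := ⟨et 0, basis_zero_mem_Ehyp⟩
  have hker : ∀ x : Ehyp n et, ωt (h z) x = 0 := by
    intro x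
    have := hh z (h.symm x)
    rw [h.apply_symm_apply] at this
    exact this.trans ((mem_Ehyp_iff halt het _).1 (h.symm x).2)
  have heq : (h z : Et) = ωt (h z) (et (Fin.last _)) • et 0 := by
    rw [← sub_eq_zero]
    refine (nondegenerate_of_symplecticBasis halt het).1 _ fun y => ?_
    obtain ⟨x, a, rfl⟩ := exists_add_smul_last halt het y
    simp [hker, (mem_Ehyp_iff halt het _).1 x.2, form_zero_last het, mul_comm]
  refine ⟨_, ?_, heq⟩
  intro hc
  rw [hc, zero_smul, Submodule.coe_eq_zero, LinearEquiv.map_eq_zero_iff] at heq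
  exact et.ne_zero 0 (congrArg Subtype.val heq)

/-- Every odd symplectic automorphism of `E` extends to a symplectic automorphism of `Ẽ`. -/
theorem exists_symplectic_extension (halt : ωt.IsAlt)
    (het : ∀ i j : Fin (2 * n + 2), (i : ℕ) < (j : ℕ) →
      ωt (et i) (et j) = if (i : ℕ) + (j : ℕ) = 2 * n + 1 then 1 else 0)
    {h : Ehyp n et ≃ₗ[ℂ] Ehyp n et} (hh : h ∈ sympGroup (ωt.restrict (Ehyp n et))) :
    ∃ g ∈ sympGroup ωt, ∀ x : Ehyp n et, g (x : Et) = h x := by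
  have : FiniteDimensional ℂ Et := et.finiteDimensional_of_finite
  have hnd := nondegenerate_of_symplecticBasis halt het
  obtain ⟨φ, hφ⟩ := LinearMap.exists_extend
    ((ωt (et (Fin.last _))).comp ((Ehyp n et).subtype.comp (h.symm : Ehyp n et →ₗ[ℂ] Ehyp n et)))
  obtain ⟨f, hf⟩ := LinearMap.exists_extend
    ((Ehyp n et).subtype.comp (h : Ehyp n et →ₗ[ℂ] Ehyp n et))
  obtain ⟨v, hv⟩ : ∃ v, ∀ x : Ehyp n et, ωt v (h x) = ωt (et (Fin.last _)) x := by
    refine ⟨(LinearMap.BilinForm.toDual ωt hnd).symm φ, fun x => ?_⟩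
    rw [LinearMap.BilinForm.apply_toDual_symm_apply]
    simpa using LinearMap.congr_fun hφ (h x)
  have hv' : ∀ x : Ehyp n et, ωt (h x) v = ωt x (et (Fin.last _)) := fun x => by
    rw [← halt.neg_eq, hv, halt.neg_eq]
  have hf' : ∀ x : Ehyp n et, f x = h x := fun x => LinearMap.congr_fun hf x
  let g₀ : Et →ₗ[ℂ] Et := f + (ωt (et 0)).smulRight (v - f (et (Fin.last _)))
  have hgE : ∀ x : Ehyp n et, g₀ x = h x := fun x => by
    simp [g₀, hf', (mem_Ehyp_iff halt het _).1 x.2]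
  have hglast : g₀ (et (Fin.last _)) = v := by simp [g₀, form_zero_last het]
  have hg₀ : ∀ y z, ωt (g₀ y) (g₀ z) = ωt y z := by
    intro y z
    obtain ⟨x, a, rfl⟩ := exists_add_smul_last halt het y
    obtain ⟨x', a', rfl⟩ := exists_add_smul_last halt het z
    have hxx : ωt (h x) (h x') = ωt x x' := hh x x'
    have hvv : ωt v v = ωt (et (Fin.last _)) (et (Fin.last _)) := by rw [halt, halt]
    simp only [map_add, map_smul, LinearMap.add_apply, LinearMap.smul_apply, hgE, hglast, hv, hv',
      hxx, hvv]
  have hinj : Function.Injective g₀ := by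
    rw [injective_iff_map_eq_zero]
    intro y hy
    refine hnd.1 y fun z => ?_
    rw [← hg₀, hy, map_zero, LinearMap.zero_apply]
  exact ⟨LinearEquiv.ofInjectiveEndo g₀ hinj, hg₀, hgE⟩

theorem finrank_quotient_Ehyp (et : Basis (Fin (2 * n + 2)) ℂ Et) :
    finrank ℂ (Et ⧸ Ehyp n et) = 1 := by
  have : FiniteDimensional ℂ Et := et.finiteDimensional_of_finite
  have hE : finrank ℂ (Ehyp n et) = 2 * n + 1 := by
    have hli := et.linearIndependent.comp Fin.castSucc (Fin.castSucc_injective _)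
    exact (finrank_span_eq_card hli).trans (Fintype.card_fin _)
  have hEt : finrank ℂ Et = 2 * n + 2 := by
    rw [finrank_eq_card_basis et, Fintype.card_fin]
  have := Submodule.finrank_quotient_add_finrank (Ehyp n et)
  omega

/-- If a symplectic automorphism `g` of `Ẽ` scales `e₀` by `c`, then `g|_E` has
determinant `c`. -/
theorem det_restrict_eq (halt : ωt.IsAlt)
    (het : ∀ i j : Fin (2 * n + 2), (i : ℕ) < (j : ℕ) →
      ωt (et i) (et j) = if (i : ℕ) + (j : ℕ) = 2 * n + 1 then 1 else 0)
    {g : Et ≃ₗ[ℂ] Et} (hg : g ∈ sympGroup ωt) {h : Ehyp n et ≃ₗ[ℂ] Ehyp n et}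
    (hgh : ∀ x : Ehyp n et, g (x : Et) = h x) {c : ℂ} (hc : c ≠ 0) (hg0 : g (et 0) = c • et 0) :
    LinearMap.det (h : Ehyp n et →ₗ[ℂ] Ehyp n et) = c := by
  have : FiniteDimensional ℂ Et := et.finiteDimensional_of_finite
  have hle : Ehyp n et ≤ (Ehyp n et).comap (g : Et →ₗ[ℂ] Et) := fun x hx => by
    simpa only [Submodule.mem_comap, LinearEquiv.coe_coe, hgh ⟨x, hx⟩] using (h ⟨x, hx⟩).2
  have hres : (g : Et →ₗ[ℂ] Et).restrict hle =
      (h : Ehyp n et →ₗ[ℂ] Ehyp n et) := by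
    ext x
    exact hgh x
  have hquot : (Ehyp n et).mapQ (Ehyp n et) (g : Et →ₗ[ℂ] Et) hle = c⁻¹ • LinearMap.id := by
    ext y
    simp only [LinearMap.comp_apply, Submodule.mkQ_apply, Submodule.mapQ_apply,
      LinearMap.smul_apply, LinearMap.id_apply, LinearEquiv.coe_coe]
    rw [← Submodule.Quotient.mk_smul, Submodule.Quotient.eq, mem_Ehyp_iff halt het]
    have hy : c * ωt (et 0) (g y) = ωt (et 0) y := by
      rw [← hg (et 0) y, hg0, map_smul, LinearMap.smul_apply, smul_eq_mul]
    rw [map_sub, map_smul, ← hy, smul_eq_mul, inv_mul_cancel_left₀ hc, sub_self]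
  have hdet := LinearMap.det_eq_det_mul_det (Ehyp n et) (g : Et →ₗ[ℂ] Et) hle
  rw [det_eq_one_of_toMatrix_eq_J _ (toMatrix_symplecticReindex halt het) hg, hres, hquot,
    LinearMap.det_smul, finrank_quotient_Ehyp, pow_one, LinearMap.det_id, mul_one] at hdet
  exact eq_of_mul_inv_eq_one hdet.symm

end SymplecticBasis

/-- The intermediate odd symplectic group
`T̃Sp_{2n+1} = {g ∈ Sp_{2n+2}(ω̃) : g e₀ = e₀}` is contained in the parabolic subgroup
`P`, and its image under the restriction homomorphism `g ↦ g|_E` is exactly the subgroup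
of elements of determinant `1` of the odd symplectic group `Sp_{2n+1}(ω)`, `ω = ω̃|_E`. -/
theorem intermediate_odd_symplectic_image
    (n : ℕ) (hn : 1 ≤ n) [FiniteDimensional ℂ Et]
    (hdim : finrank ℂ Et = 2 * n + 2)
    (ωt : LinearMap.BilinForm ℂ Et) (halt : ωt.IsAlt)
    (et : Basis (Fin (2 * n + 2)) ℂ Et)
    (het : ∀ i j : Fin (2 * n + 2), (i : ℕ) < (j : ℕ) →
      ωt (et i) (et j) = if (i : ℕ) + (j : ℕ) = 2 * n + 1 then 1 else 0) :
    -- the intermediate odd symplectic group is contained in P …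
    (∀ g ∈ sympGroup ωt, (g : Et ≃ₗ[ℂ] Et) (et 0) = et 0 → g ∈ Psub n ωt et) ∧
    -- … and its image under restriction to E is the subgroup of elements of
    -- determinant 1 of the odd symplectic group
    (∀ h : ↥(Ehyp n et) ≃ₗ[ℂ] ↥(Ehyp n et), h ∈ sympGroup (ωt.restrict (Ehyp n et)) →
      ((∃ g ∈ sympGroup ωt, (g : Et ≃ₗ[ℂ] Et) (et 0) = et 0 ∧
          ∀ x : ↥(Ehyp n et), (g : Et ≃ₗ[ℂ] Et) (x : Et) = ((h x : ↥(Ehyp n et)) : Et)) ↔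
        LinearMap.det (h : ↥(Ehyp n et) →ₗ[ℂ] ↥(Ehyp n et)) = 1)) := by
  refine ⟨fun g hg hg0 => ⟨hg, ?_⟩, fun h hh => ⟨?_, fun hdet => ?_⟩⟩
  · change Submodule.map (g : Et →ₗ[ℂ] Et) (Submodule.span ℂ {et 0}) = Submodule.span ℂ {et 0}
    rw [Submodule.map_span, Set.image_singleton, LinearEquiv.coe_coe, hg0]
  · rintro ⟨g, hg, hg0, hgh⟩
    exact det_restrict_eq halt het hg hgh one_ne_zero (by rw [hg0, one_smul])
  · obtain ⟨g, hg, hgh⟩ := exists_symplectic_extension halt het hh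
    obtain ⟨c, hc, hh0⟩ := exists_apply_zero_eq_smul halt het hh
    have hg0 : g (et 0) = c • et 0 := (hgh ⟨et 0, basis_zero_mem_Ehyp⟩).trans hh0
    rw [det_restrict_eq halt het hg hgh hc hg0] at hdet
    exact ⟨g, hg, by rw [hg0, hdet, one_smul], hgh⟩

end
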